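/- arXiv:2404.02246 — 3 statements merged into one kernel-verified Lean document; each statement's English description precedes it below -/
import Mathlib

section
/- Let 1 < t < ∞. There exists a 2×2 matrix weight W on ℝ with [W]_{A_{t,∞}} < ∞ such that [W]_{A_{s,∞},𝒟} = ∞ for all 1 ≤ s < t. -/
open MeasureTheory ENNReal
open scoped ComplexOrder

noncomputable section

/-- The power `A^a` of a matrix, defined via the continuous functional calculus
(for positive definite Hermitian matrices this diagonalizes `A` and raises the
eigenvalues to the `a`-th power). -/
def matRpow {d : ℕ} (A : Matrix (Fin d) (Fin d) ℂ) (a : ℝ) : Matrix (Fin d) (Fin d) ℂ :=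
  cfc (fun x : ℝ => x ^ a) A

/-- The spectral norm (largest singular value) of a matrix, i.e. its norm as an operator
on the Euclidean space `ℂ^d`. -/
def specNorm {d : ℕ} (A : Matrix (Fin d) (Fin d) ℂ) : ℝ :=
  ‖Matrix.toEuclideanCLM (𝕜 := ℂ) A‖

/-- Hölder conjugate exponent. -/
def conjExp (p : ℝ) : ℝ := p / (p - 1)

/-- The Lebesgue average `⨍_Q f dμ` of an `ℝ≥0∞`-valued function. -/
def lavg {α : Type*} [MeasurableSpace α] (μ : Measure α) (Q : Set α) (f : α → ℝ≥0∞) : ℝ≥0∞ :=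
  (μ Q)⁻¹ * ∫⁻ x in Q, f x ∂μ

/-- The two-exponent matrix Muckenhoupt characteristic `[W]_{A_{p,q}}`, with the supremum
taken over a family `S` of sets. -/
def matApq {α : Type*} [MeasurableSpace α] {d : ℕ} (μ : Measure α) (S : Set (Set α))
    (W : α → Matrix (Fin d) (Fin d) ℂ) (p q : ℝ) : ℝ≥0∞ :=
  ⨆ Q ∈ S, lavg μ Q fun x =>
    (lavg μ Q fun y =>
        ENNReal.ofReal (specNorm (matRpow (W x) (1 / q) * matRpow (W y) (-(1 / q))))
          ^ conjExp p) ^ (q / conjExp p)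

/-- The endpoint matrix Muckenhoupt characteristic `[W]_{A_{t,∞}}`, with the supremum
taken over a family `S` of sets. -/
def matAtInfty {α : Type*} [MeasurableSpace α] {d : ℕ} (μ : Measure α) (S : Set (Set α))
    (W : α → Matrix (Fin d) (Fin d) ℂ) (t : ℝ) : ℝ≥0∞ :=
  ⨆ Q ∈ S, essSup (fun x =>
    lavg μ Q fun y =>
      ENNReal.ofReal (specNorm (matRpow (W x) (1 / t) * matRpow (W y) (-(1 / t)))) ^ t)
    (μ.restrict Q)

/-- The scalar reverse Hölder characteristic `[w]_{RH_s}`, with the supremum taken over a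
family `S` of sets. -/
def scalRH {α : Type*} [MeasurableSpace α] (μ : Measure α) (S : Set (Set α))
    (w : α → ℝ) (s : ℝ) : ℝ≥0∞ :=
  ⨆ Q ∈ S, (lavg μ Q fun x => ENNReal.ofReal (w x) ^ s) ^ (1 / s) /
    lavg μ Q fun x => ENNReal.ofReal (w x)

/-- The scalar reverse Hölder characteristic `[w]_{RH_∞}`, with the supremum taken over a
family `S` of sets. -/
def scalRHInfty {α : Type*} [MeasurableSpace α] (μ : Measure α) (S : Set (Set α))
    (w : α → ℝ) : ℝ≥0∞ :=
  ⨆ Q ∈ S, essSup (fun x => ENNReal.ofReal (w x)) (μ.restrict Q) /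
    lavg μ Q fun x => ENNReal.ofReal (w x)

/-- The matrix reverse Hölder characteristic `[W]_{RH_{t,s}}`. -/
def matRH {α : Type*} [MeasurableSpace α] {d : ℕ} (μ : Measure α) (S : Set (Set α))
    (W : α → Matrix (Fin d) (Fin d) ℂ) (t s : ℝ) : ℝ≥0∞ :=
  ⨆ (e : EuclideanSpace ℂ (Fin d)) (_ : e ≠ 0),
    scalRH μ S (fun x => ‖Matrix.toEuclideanCLM (𝕜 := ℂ) (matRpow (W x) (1 / t)) e‖ ^ t) s

/-- The matrix reverse Hölder characteristic `[W]_{RH_{t,∞}}`. -/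
def matRHInfty {α : Type*} [MeasurableSpace α] {d : ℕ} (μ : Measure α) (S : Set (Set α))
    (W : α → Matrix (Fin d) (Fin d) ℂ) (t : ℝ) : ℝ≥0∞ :=
  ⨆ (e : EuclideanSpace ℂ (Fin d)) (_ : e ≠ 0),
    scalRHInfty μ S (fun x => ‖Matrix.toEuclideanCLM (𝕜 := ℂ) (matRpow (W x) (1 / t)) e‖ ^ t)

/-- An axis-parallel cube in `ℝ^n` with corner `c` and positive side length `h`. -/
def cube {n : ℕ} (c : Fin n → ℝ) (h : ℝ) : Set (Fin n → ℝ) :=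
  {x | ∀ i, x i ∈ Set.Ico (c i) (c i + h)}

/-- The family of all axis-parallel cubes in `ℝ^n`. -/
def cubes (n : ℕ) : Set (Set (Fin n → ℝ)) :=
  {Q | ∃ (c : Fin n → ℝ) (h : ℝ), 0 < h ∧ Q = cube c h}

/-- The family of all (left-closed right-open, nontrivial, bounded) intervals in `ℝ`,
i.e. the axis-parallel "cubes" of `ℝ^1`. -/
def intervalsR : Set (Set ℝ) := {I | ∃ a b : ℝ, a < b ∧ I = Set.Ico a b}

/-- The family of all dyadic intervals `[m·2^k, (m+1)·2^k)`, `m, k ∈ ℤ`, in `ℝ`. -/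
def dyadicsR : Set (Set ℝ) :=
  {I | ∃ m k : ℤ, I = Set.Ico ((m : ℝ) * 2 ^ k) (((m : ℝ) + 1) * 2 ^ k)}

/-- A `d×d` matrix weight: a locally integrable matrix-valued function whose values are
a.e. positive definite (Hermitian). -/
def IsMatrixWeight {α : Type*} [MeasurableSpace α] [TopologicalSpace α] {d : ℕ}
    (μ : Measure α) (W : α → Matrix (Fin d) (Fin d) ℂ) : Prop :=
  (∀ i j, LocallyIntegrable (fun x => W x i j) μ) ∧ ∀ᵐ x ∂μ, (W x).PosDef


/-- The orthogonal projection of `ℂ²` onto the line spanned by `(1, h)`. -/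
def lineProj (h : ℝ) : Matrix (Fin 2) (Fin 2) ℂ :=
  ((1 + h ^ 2)⁻¹ : ℝ) • !![1, (h : ℂ); (h : ℂ), (h : ℂ) ^ 2]

/-- The matrix acting as `c` on the line spanned by `(1, h)` and as the identity on its
orthogonal complement. -/
def lineScale (c h : ℝ) : Matrix (Fin 2) (Fin 2) ℂ :=
  c • lineProj h + (1 - lineProj h)

lemma one_add_sq_ne_zero_complex (h : ℝ) : (1 + (h : ℂ) ^ 2) ≠ 0 := by
  have : (1 + h ^ 2 : ℝ) ≠ 0 := by positivity
  exact_mod_cast this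

lemma isStarProjection_lineProj (h : ℝ) : IsStarProjection (lineProj h) := by
  have h0 := one_add_sq_ne_zero_complex h
  constructor
  · ext i j
    fin_cases i <;> fin_cases j <;>
      simp [lineProj, Matrix.mul_apply, Fin.sum_univ_two] <;> field_simp
  · ext i j
    fin_cases i <;> fin_cases j <;> simp [lineProj, Matrix.star_apply]

lemma matRpow_lineScale (c h a : ℝ) :
    matRpow (lineScale c h) a = lineScale (c ^ a) h := by
  have hP := isStarProjection_lineProj h
  have hsa : IsSelfAdjoint (lineProj h) := hP.isSelfAdjoint
  have hfin : (spectrum ℝ (lineProj h)).Finite :=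
    (Set.toFinite {0, 1}).subset (IsIdempotentElem.spectrum_subset ℝ hP.isIdempotentElem)
  have affine (c : ℝ) : cfc (fun x : ℝ => c * x + (1 - x)) (lineProj h) = lineScale c h := by
    have : (fun x : ℝ => c * x + (1 - x)) = fun x => 1 + (c - 1) * x := by ext; ring
    rw [this, cfc_const_add (1 : ℝ) _ _ (by fun_prop) hsa, cfc_const_mul_id _ _ hsa, lineScale]
    simp only [map_one, sub_smul, one_smul]
    abel
  rw [matRpow, ← affine c, ← cfc_comp _ _ _ hsa ((hfin.image _).continuousOn _) (by fun_prop),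
    ← affine (c ^ a)]
  refine cfc_congr fun x hx => ?_
  rcases IsIdempotentElem.spectrum_subset ℝ hP.isIdempotentElem hx with rfl | rfl <;> simp

lemma posDef_lineScale {c : ℝ} (h : ℝ) (hc : 0 < c) (hc1 : c ≤ 1) : (lineScale c h).PosDef := by
  have hP := (isStarProjection_lineProj h).one_sub
  have hQ : (1 - lineProj h).PosSemidef := by
    have := Matrix.posSemidef_conjTranspose_mul_self (1 - lineProj h)
    rwa [← Matrix.star_eq_conjTranspose, hP.isSelfAdjoint.star_eq,
      hP.isIdempotentElem.eq] at this
  have : lineScale c h = c • 1 + (1 - c) • (1 - lineProj h) := by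
    simp only [lineScale, sub_smul, smul_sub, one_smul]
    abel
  rw [this]
  exact (Matrix.PosDef.one.smul hc).add_posSemidef (hQ.smul (sub_nonneg.2 hc1))

section

open scoped Matrix.Norms.L2Operator

lemma specNorm_eq_norm {d : ℕ} (A : Matrix (Fin d) (Fin d) ℂ) : specNorm A = ‖A‖ := rfl

lemma specNorm_nonneg {d : ℕ} (A : Matrix (Fin d) (Fin d) ℂ) : 0 ≤ specNorm A := norm_nonneg _

lemma norm_apply_le_specNorm {d : ℕ} (A : Matrix (Fin d) (Fin d) ℂ) (i j : Fin d) :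
    ‖A i j‖ ≤ specNorm A := by
  have h := (Matrix.toEuclideanCLM (𝕜 := ℂ) A).le_opNorm (EuclideanSpace.single j 1)
  have h' := PiLp.norm_apply_le (Matrix.toEuclideanCLM (𝕜 := ℂ) A (EuclideanSpace.single j 1)) i
  simp [Matrix.ofLp_toEuclideanCLM] at h h'
  exact h'.trans h

lemma norm_lineProj_sub_zero_le {h : ℝ} (hh : 0 ≤ h) : ‖lineProj h - lineProj 0‖ ≤ h := by
  have h0 := one_add_sq_ne_zero_complex h
  have key : star (lineProj h - lineProj 0) * (lineProj h - lineProj 0)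
      = (h ^ 2 / (1 + h ^ 2)) • (1 : Matrix (Fin 2) (Fin 2) ℂ) := by
    ext i j
    fin_cases i <;> fin_cases j <;>
      simp [lineProj, Matrix.mul_apply, Fin.sum_univ_two, Matrix.star_apply] <;> field_simp <;>
      ring
  have hn := CStarRing.norm_star_mul_self (x := lineProj h - lineProj 0)
  rw [key, norm_smul, norm_one, mul_one, Real.norm_of_nonneg (by positivity)] at hn
  have : h ^ 2 / (1 + h ^ 2) ≤ h ^ 2 := div_le_self (by positivity) (by nlinarith)
  exact abs_le_of_sq_le_sq' (by nlinarith) hh |>.2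

lemma norm_one_sub_lineProj_mul_lineProj_le {h k : ℝ} (hh : 0 ≤ h) (hk : 0 ≤ k) :
    ‖(1 - lineProj h) * lineProj k‖ ≤ h + k := by
  have hP := isStarProjection_lineProj k
  have e : (1 - lineProj h) * lineProj k
      = ((lineProj k - lineProj 0) - (lineProj h - lineProj 0)) * lineProj k := by
    rw [sub_sub_sub_cancel_right, sub_mul, sub_mul, one_mul, hP.isIdempotentElem.eq]
  calc _ ≤ ‖(lineProj k - lineProj 0) - (lineProj h - lineProj 0)‖ * ‖lineProj k‖ := by
        rw [e]; exact norm_mul_le _ _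
    _ ≤ (k + h) * 1 := by
        gcongr
        · exact (norm_sub_le _ _).trans
            (add_le_add (norm_lineProj_sub_zero_le hk) (norm_lineProj_sub_zero_le hh))
        · exact IsStarProjection.norm_le _ hP
    _ = h + k := by ring

lemma specNorm_lineScale_mul_le {h k b : ℝ} (hh : 0 ≤ h) (hh1 : h ≤ 1) (hk : 0 ≤ k)
    (hb : 0 ≤ b) (hbk : b * k ≤ 1) :
    specNorm (lineScale h h * lineScale b k) ≤ 2 * (h * b) + 3 := by
  have hP := isStarProjection_lineProj h
  have hR := isStarProjection_lineProj k
  have nP := IsStarProjection.norm_le _ hP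
  have nR := IsStarProjection.norm_le _ hR
  have nP' := IsStarProjection.norm_le _ hP.one_sub
  have nR' := IsStarProjection.norm_le _ hR.one_sub
  have e : lineScale h h * lineScale b k
      = (h * b) • (lineProj h * lineProj k) + h • (lineProj h * (1 - lineProj k))
        + b • ((1 - lineProj h) * lineProj k) + (1 - lineProj h) * (1 - lineProj k) := by
    simp only [lineScale, add_mul, mul_add, smul_mul_assoc, mul_smul_comm, smul_smul, smul_add]
    rw [mul_comm b h]
    abel
  have prod_le {A B : Matrix (Fin 2) (Fin 2) ℂ} (hA : ‖A‖ ≤ 1) (hB : ‖B‖ ≤ 1) : ‖A * B‖ ≤ 1 :=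
    (norm_mul_le _ _).trans (mul_le_one₀ hA (norm_nonneg _) hB)
  have n1 : ‖(h * b) • (lineProj h * lineProj k)‖ ≤ h * b := by
    rw [norm_smul, Real.norm_of_nonneg (by positivity)]
    exact mul_le_of_le_one_right (by positivity) (prod_le nP nR)
  have n2 : ‖h • (lineProj h * (1 - lineProj k))‖ ≤ 1 := by
    rw [norm_smul, Real.norm_of_nonneg hh]
    exact mul_le_one₀ hh1 (norm_nonneg _) (prod_le nP nR')
  have n3 : ‖b • ((1 - lineProj h) * lineProj k)‖ ≤ b * (h + k) := by
    rw [norm_smul, Real.norm_of_nonneg hb]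
    exact mul_le_mul_of_nonneg_left (norm_one_sub_lineProj_mul_lineProj_le hh hk) hb
  have n4 := prod_le nP' nR'
  rw [specNorm_eq_norm, e]
  have := norm_add₄_le (a := (h * b) • (lineProj h * lineProj k))
    (b := h • (lineProj h * (1 - lineProj k))) (c := b • ((1 - lineProj h) * lineProj k))
    (d := (1 - lineProj h) * (1 - lineProj k))
  nlinarith

lemma le_specNorm_lineScale_mul {h k : ℝ} (a : ℝ) {b : ℝ} (hh : 0 ≤ h) (hhk : h ≤ k)
    (hk1 : k ≤ 1) (hb : 0 ≤ b) :
    b * ((k - h) / 4) ≤ specNorm (lineScale a h * lineScale b k) := by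
  have hP := isStarProjection_lineProj h
  have hR := isStarProjection_lineProj k
  have e : (1 - lineProj h) * (lineScale a h * lineScale b k) * lineProj k
      = b • ((1 - lineProj h) * lineProj k) := by
    have e1 : (1 - lineProj h) * lineScale a h = 1 - lineProj h := by
      rw [lineScale, mul_add, mul_smul_comm, hP.one_sub.isIdempotentElem.eq,
        sub_mul, one_mul, hP.isIdempotentElem.eq, sub_self, smul_zero, zero_add]
    have e2 : lineScale b k * lineProj k = b • lineProj k := by
      rw [lineScale, add_mul, smul_mul_assoc, hR.isIdempotentElem.eq,
        sub_mul, one_mul, hR.isIdempotentElem.eq, sub_self, add_zero]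
    rw [← mul_assoc, e1, mul_assoc, e2, mul_smul_comm]
  have upper : ‖(1 - lineProj h) * (lineScale a h * lineScale b k) * lineProj k‖
      ≤ ‖lineScale a h * lineScale b k‖ := by
    calc _ ≤ ‖1 - lineProj h‖ * ‖lineScale a h * lineScale b k‖ * ‖lineProj k‖ :=
          (norm_mul_le _ _).trans (by gcongr; exact norm_mul_le _ _)
      _ ≤ 1 * ‖lineScale a h * lineScale b k‖ * 1 := by
          gcongr
          · exact IsStarProjection.norm_le _ hP.one_sub
          · exact IsStarProjection.norm_le _ hR
      _ = _ := by ring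
  have entry : ((1 - lineProj h) * lineProj k) 1 0
      = (((k - h) / ((1 + h ^ 2) * (1 + k ^ 2)) : ℝ) : ℂ) := by
    have h0 := one_add_sq_ne_zero_complex h
    have k0 := one_add_sq_ne_zero_complex k
    simp [lineProj, Matrix.mul_apply, Fin.sum_univ_two]
    field_simp
    ring
  have lower : (k - h) / 4 ≤ ‖(1 - lineProj h) * lineProj k‖ := by
    refine le_trans ?_ (norm_apply_le_specNorm _ 1 0)
    have hk : 0 ≤ k := hh.trans hhk
    have hh1 : h ≤ 1 := hhk.trans hk1
    rw [entry, Complex.norm_real, Real.norm_of_nonneg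
      (div_nonneg (sub_nonneg.2 hhk) (by positivity))]
    refine div_le_div_of_nonneg_left (sub_nonneg.2 hhk) (by positivity) ?_
    have : (1 + h ^ 2) * (1 + k ^ 2) ≤ 2 * 2 := by
      gcongr <;> nlinarith
    linarith
  rw [e, norm_smul, Real.norm_of_nonneg hb] at upper
  exact (mul_le_mul_of_nonneg_left lower hb).trans upper

end

lemma setLIntegral_abs_rpow_neg_half_le {c : ℝ} (hc : 0 ≤ c) :
    ∫⁻ y in Set.Ioo (-c) c, ENNReal.ofReal (|y| ^ (-(1 / 2) : ℝ)) ≤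
      ENNReal.ofReal (4 * c ^ (1 / 2 : ℝ)) := by
  have right : ∫⁻ y in Set.Ioc 0 c, ENNReal.ofReal (|y| ^ (-(1 / 2) : ℝ)) =
      ENNReal.ofReal (2 * c ^ (1 / 2 : ℝ)) := by
    have hint : IntegrableOn (fun y : ℝ => y ^ (-(1 / 2) : ℝ)) (Set.Ioc 0 c) :=
      (intervalIntegrable_iff_integrableOn_Ioc_of_le hc).1
        (intervalIntegral.intervalIntegrable_rpow' (by norm_num))
    have hval := integral_rpow (a := 0) (b := c) (r := -(1 / 2)) (Or.inl (by norm_num))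
    rw [intervalIntegral.integral_of_le hc, Real.zero_rpow (by norm_num)] at hval
    norm_num at hval
    calc _ = ∫⁻ y in Set.Ioc 0 c, ENNReal.ofReal (y ^ (-(1 / 2) : ℝ)) :=
          setLIntegral_congr_fun measurableSet_Ioc fun y hy => by
            simp only [abs_of_pos hy.1]
      _ = ENNReal.ofReal (∫ y in Set.Ioc 0 c, y ^ (-(1 / 2) : ℝ)) :=
          (ofReal_integral_eq_lintegral_ofReal hint
            ((ae_restrict_mem measurableSet_Ioc).mono fun y hy =>
              Real.rpow_nonneg hy.1.le _)).symm
      _ = _ := by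
          congr 1
          norm_num
          rw [hval]
          ring
  have left : ∫⁻ y in Set.Ico (-c) 0, ENNReal.ofReal (|y| ^ (-(1 / 2) : ℝ)) =
      ENNReal.ofReal (2 * c ^ (1 / 2 : ℝ)) := by
    have := (Measure.measurePreserving_neg (volume : Measure ℝ)).setLIntegral_comp_preimage_emb
      (MeasurableEquiv.neg ℝ).measurableEmbedding
      (fun y => ENNReal.ofReal (|y| ^ (-(1 / 2) : ℝ))) (Set.Ioc 0 c)
    rw [right] at this
    simpa using this
  calc _ ≤ ∫⁻ y in Set.Ico (-c) 0 ∪ ({0} ∪ Set.Ioc 0 c),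
        ENNReal.ofReal (|y| ^ (-(1 / 2) : ℝ)) := by
        refine lintegral_mono_set fun y hy => ?_
        rcases lt_trichotomy y 0 with h | h | h
        · exact Or.inl ⟨hy.1.le, h⟩
        · exact Or.inr (Or.inl h)
        · exact Or.inr (Or.inr ⟨h, hy.2.le⟩)
    _ ≤ ENNReal.ofReal (2 * c ^ (1 / 2 : ℝ)) + (0 + ENNReal.ofReal (2 * c ^ (1 / 2 : ℝ))) := by
        refine (lintegral_union_le _ _ _).trans (add_le_add left.le ?_)
        exact (lintegral_union_le _ _ _).trans (add_le_add (by simp) right.le)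
    _ = _ := by
        rw [zero_add, ← ENNReal.ofReal_add (by positivity) (by positivity)]
        congr 1
        ring

/-- The truncated modulus `min 1 |y|`. -/
def truncAbs (y : ℝ) : ℝ := min 1 |y|

lemma truncAbs_nonneg (y : ℝ) : 0 ≤ truncAbs y := le_min zero_le_one (abs_nonneg y)

lemma truncAbs_le_one (y : ℝ) : truncAbs y ≤ 1 := min_le_left _ _

lemma truncAbs_of_mem_Icc {y : ℝ} (h0 : 0 ≤ y) (h1 : y ≤ 1) : truncAbs y = y := by
  rw [truncAbs, abs_of_nonneg h0, min_eq_right h1]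

@[fun_prop]
lemma continuous_truncAbs : Continuous truncAbs := by unfold truncAbs; fun_prop

lemma rpow_half_mul_rpow_neg_half_le {u v c : ℝ} (hu : 0 ≤ u) (hv : 0 ≤ v) (hc : 0 ≤ c)
    (h : u ≤ c ^ 2 * v) : u ^ (1 / 2 : ℝ) * v ^ (-(1 / 2) : ℝ) ≤ c := by
  rcases hv.eq_or_lt with rfl | hv
  · rw [Real.zero_rpow (by norm_num), mul_zero]
    exact hc
  rw [Real.rpow_neg hv.le, ← Real.inv_rpow hv.le, ← Real.mul_rpow hu (by positivity),
    ← Real.sqrt_eq_rpow]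
  refine Real.sqrt_le_iff.2 ⟨hc, ?_⟩
  rw [← div_eq_mul_inv]
  exact (div_le_iff₀ hv).2 h

/-- The scalar weight `(min 1 |y|) ^ (-1/2)` is an `A₁` weight. -/
lemma setLIntegral_truncAbs_le {a b x : ℝ} (hx : x ∈ Set.Ico a b) :
    ∫⁻ y in Set.Ico a b,
        ENNReal.ofReal (truncAbs x ^ (1 / 2 : ℝ) * truncAbs y ^ (-(1 / 2) : ℝ)) ≤
      ENNReal.ofReal (17 * (b - a)) := by
  obtain ⟨hxa, hxb⟩ := hx
  have hl : 0 < b - a := by linarith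
  have hvol (K : ℝ) (hK : 0 ≤ K) :
      ∫⁻ _ in Set.Ico a b, ENNReal.ofReal K = ENNReal.ofReal (K * (b - a)) := by
    rw [setLIntegral_const, Real.volume_Ico, ENNReal.ofReal_mul hK]
  rcases le_or_gt |x| (2 * (b - a)) with hsmall | hlarge
  · set l := b - a with hl_def
    have bound (y : ℝ) : truncAbs x ^ (1 / 2 : ℝ) * truncAbs y ^ (-(1 / 2) : ℝ) ≤
        1 + 2 * l ^ (1 / 2 : ℝ) * |y| ^ (-(1 / 2) : ℝ) := by
      rcases le_total 1 |y| with hy | hy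
      · have h1 : truncAbs x ^ (1 / 2 : ℝ) ≤ 1 :=
          Real.rpow_le_one (truncAbs_nonneg x) (truncAbs_le_one x) (by norm_num)
        have h2 : truncAbs y = 1 := min_eq_left hy
        rw [h2, Real.one_rpow, mul_one]
        have : 0 ≤ 2 * l ^ (1 / 2 : ℝ) * |y| ^ (-(1 / 2) : ℝ) := by positivity
        linarith
      · have h1 : truncAbs x ^ (1 / 2 : ℝ) ≤ 2 * l ^ (1 / 2 : ℝ) := by
          have : (2 : ℝ) * l ^ (1 / 2 : ℝ) = (4 * l) ^ (1 / 2 : ℝ) := by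
            rw [Real.mul_rpow (by norm_num) hl.le]
            congr 1
            rw [← Real.sqrt_eq_rpow, show (4 : ℝ) = 2 ^ 2 by norm_num,
              Real.sqrt_sq (by norm_num)]
          rw [this]
          refine Real.rpow_le_rpow (truncAbs_nonneg x) ?_ (by norm_num)
          have : truncAbs x ≤ |x| := min_le_right _ _
          linarith
        have h2 : truncAbs y = |y| := min_eq_right hy
        rw [h2]
        have := mul_le_mul_of_nonneg_right h1 (Real.rpow_nonneg (abs_nonneg y) (-(1 / 2)))
        linarith
    have hsub : Set.Ico a b ⊆ Set.Ioo (-(4 * l)) (4 * l) := by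
      intro y hy
      have := abs_le.1 hsmall
      exact ⟨by linarith [hy.1], by linarith [hy.2]⟩
    calc _ ≤ ∫⁻ y in Set.Ico a b, (ENNReal.ofReal 1 +
          ENNReal.ofReal (2 * l ^ (1 / 2 : ℝ)) * ENNReal.ofReal (|y| ^ (-(1 / 2) : ℝ))) := by
          refine lintegral_mono fun y => ?_
          rw [← ENNReal.ofReal_mul (by positivity), ← ENNReal.ofReal_add (by norm_num)
            (by positivity)]
          exact ENNReal.ofReal_le_ofReal (bound y)
      _ = ENNReal.ofReal (1 * l) + ENNReal.ofReal (2 * l ^ (1 / 2 : ℝ)) *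
          ∫⁻ y in Set.Ico a b, ENNReal.ofReal (|y| ^ (-(1 / 2) : ℝ)) := by
          rw [lintegral_add_left measurable_const, hvol 1 (by norm_num),
            lintegral_const_mul' _ _ ENNReal.ofReal_ne_top]
      _ ≤ ENNReal.ofReal (1 * l) + ENNReal.ofReal (2 * l ^ (1 / 2 : ℝ)) *
          ENNReal.ofReal (4 * (4 * l) ^ (1 / 2 : ℝ)) := by
          gcongr
          exact (lintegral_mono_set hsub).trans
            (setLIntegral_abs_rpow_neg_half_le (by positivity))
      _ = _ := by
          rw [← ENNReal.ofReal_mul (by positivity), ← ENNReal.ofReal_add (by positivity)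
            (by positivity)]
          congr 1
          rw [← Real.sqrt_eq_rpow, ← Real.sqrt_eq_rpow, Real.sqrt_mul (by norm_num),
            show (4 : ℝ) = 2 ^ 2 by norm_num, Real.sqrt_sq (by norm_num)]
          linear_combination 16 * Real.mul_self_sqrt hl.le
  · calc _ ≤ ∫⁻ y in Set.Ico a b, ENNReal.ofReal 2 := by
          refine setLIntegral_mono measurable_const fun y hy => ENNReal.ofReal_le_ofReal ?_
          refine rpow_half_mul_rpow_neg_half_le (truncAbs_nonneg x) (truncAbs_nonneg y)
            (by norm_num) ?_
          have hxy : |x| - |y| ≤ b - a := (abs_sub_abs_le_abs_sub x y).trans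
            (abs_le.2 ⟨by linarith [hy.2], by linarith [hy.1]⟩)
          unfold truncAbs
          rcases le_total 1 |y| with h | h
          · rw [min_eq_left h]
            linarith [min_le_left 1 |x|]
          · rw [min_eq_right h]
            linarith [min_le_right 1 |x|]
      _ = ENNReal.ofReal (2 * (b - a)) := hvol 2 (by norm_num)
      _ ≤ _ := ENNReal.ofReal_le_ofReal (by linarith)

/-- The weight with eigenvalue `(min 1 |y|) ^ (1/2)` on the line of slope
`(min 1 |y|) ^ (1 / (2 * t))`, and eigenvalue `1` on its orthogonal complement. -/
def rotatingWeight (t : ℝ) (y : ℝ) : Matrix (Fin 2) (Fin 2) ℂ :=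
  lineScale (truncAbs y ^ (1 / 2 : ℝ)) (truncAbs y ^ (1 / 2 * (1 / t) : ℝ))

lemma matRpow_rotatingWeight (t y a : ℝ) :
    matRpow (rotatingWeight t y) a =
      lineScale (truncAbs y ^ (1 / 2 * a : ℝ)) (truncAbs y ^ (1 / 2 * (1 / t) : ℝ)) := by
  rw [rotatingWeight, matRpow_lineScale, Real.rpow_mul (truncAbs_nonneg y) _ a]

lemma continuous_lineProj : Continuous lineProj := by
  have hinv : Continuous fun h : ℝ => (1 + h ^ 2)⁻¹ :=
    Continuous.inv₀ (by fun_prop) fun h => by positivity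
  refine hinv.smul ?_
  refine continuous_matrix fun i j => ?_
  fin_cases i <;> fin_cases j <;> simp <;> fun_prop

lemma isMatrixWeight_rotatingWeight {t : ℝ} (ht : 0 < t) :
    IsMatrixWeight (volume : Measure ℝ) (rotatingWeight t) := by
  constructor
  · intro i j
    have hP : Continuous fun y => lineProj (truncAbs y ^ (1 / 2 * (1 / t) : ℝ)) :=
      continuous_lineProj.comp
        (continuous_truncAbs.rpow_const fun y => Or.inr (by positivity))
    have hc : Continuous fun y => truncAbs y ^ (1 / 2 : ℝ) :=
      continuous_truncAbs.rpow_const fun y => Or.inr (by positivity)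
    have hW : Continuous (rotatingWeight t) :=
      (hc.smul hP).add (continuous_const.sub hP)
    exact (hW.matrix_elem i j).locallyIntegrable
  · have h0 : ∀ᵐ y : ℝ ∂volume, y ≠ 0 := Measure.ae_ne volume 0
    filter_upwards [h0] with y hy
    have hpos : 0 < truncAbs y := lt_min one_pos (abs_pos.2 hy)
    exact posDef_lineScale _ (Real.rpow_pos_of_pos hpos _)
      (Real.rpow_le_one hpos.le (truncAbs_le_one y) (by norm_num))

lemma specNorm_rotatingWeight_rpow_le {t : ℝ} (ht : 0 < t) (x y : ℝ) :
    specNorm (matRpow (rotatingWeight t x) (1 / t) * matRpow (rotatingWeight t y) (-(1 / t))) ^ t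
      ≤ 5 ^ t * (1 + truncAbs x ^ (1 / 2 : ℝ) * truncAbs y ^ (-(1 / 2) : ℝ)) := by
  have hx := truncAbs_nonneg x
  have hy := truncAbs_nonneg y
  rw [matRpow_rotatingWeight, matRpow_rotatingWeight]
  set h := truncAbs x ^ (1 / 2 * (1 / t) : ℝ)
  set b := truncAbs y ^ (1 / 2 * -(1 / t) : ℝ)
  have hh : 0 ≤ h := Real.rpow_nonneg hx _
  have hb : 0 ≤ b := Real.rpow_nonneg hy _
  have hbk : b * truncAbs y ^ (1 / 2 * (1 / t) : ℝ) ≤ 1 := by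
    simp only [b]
    rw [mul_neg, Real.rpow_neg hy]
    exact inv_mul_le_one
  have hM := specNorm_lineScale_mul_le hh (Real.rpow_le_one hx (truncAbs_le_one x)
    (by positivity)) (Real.rpow_nonneg hy _) hb hbk
  have hpow : (h * b) ^ t = truncAbs x ^ (1 / 2 : ℝ) * truncAbs y ^ (-(1 / 2) : ℝ) := by
    simp only [h, b]
    rw [Real.mul_rpow hh hb, ← Real.rpow_mul hx, ← Real.rpow_mul hy]
    congr 2 <;> field_simp
  have hmax : 2 * (h * b) + 3 ≤ 5 * max 1 (h * b) := by
    linarith [le_max_left 1 (h * b), le_max_right 1 (h * b)]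
  calc _ ≤ (5 * max 1 (h * b)) ^ t :=
        Real.rpow_le_rpow (specNorm_nonneg _) (hM.trans hmax) ht.le
    _ = 5 ^ t * max 1 (h * b) ^ t := Real.mul_rpow (by norm_num) (by positivity)
    _ ≤ 5 ^ t * (1 + (h * b) ^ t) := by
        gcongr
        have hnn : 0 ≤ (h * b) ^ t := by positivity
        rcases max_choice 1 (h * b) with e | e <;> rw [e]
        · rw [Real.one_rpow]; linarith
        · linarith
    _ = _ := by rw [hpow]

lemma matAtInfty_rotatingWeight_lt_top {t : ℝ} (ht : 0 < t) :
    matAtInfty volume intervalsR (rotatingWeight t) t < ⊤ := by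
  refine lt_of_le_of_lt (b := ENNReal.ofReal (5 ^ t) * (1 + ENNReal.ofReal 17)) ?_
    (ENNReal.mul_lt_top ENNReal.ofReal_lt_top
      (ENNReal.add_lt_top.2 ⟨ENNReal.one_lt_top, ENNReal.ofReal_lt_top⟩))
  refine iSup₂_le fun Q hQ => ?_
  obtain ⟨a, b, hab, rfl⟩ := hQ
  refine essSup_le_of_ae_le _ ?_
  filter_upwards [ae_restrict_mem measurableSet_Ico] with x hx
  have hl : 0 < b - a := sub_pos.2 hab
  have hint : ∫⁻ y in Set.Ico a b, ENNReal.ofReal (specNorm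
      (matRpow (rotatingWeight t x) (1 / t) * matRpow (rotatingWeight t y) (-(1 / t)))) ^ t ≤
      ENNReal.ofReal (5 ^ t) * (ENNReal.ofReal (b - a) + ENNReal.ofReal (17 * (b - a))) := by
    calc _ ≤ ∫⁻ y in Set.Ico a b, ENNReal.ofReal (5 ^ t) * (1 +
          ENNReal.ofReal (truncAbs x ^ (1 / 2 : ℝ) * truncAbs y ^ (-(1 / 2) : ℝ))) := by
          refine lintegral_mono fun y => ?_
          have hnn : 0 ≤ truncAbs x ^ (1 / 2 : ℝ) * truncAbs y ^ (-(1 / 2) : ℝ) :=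
            mul_nonneg (Real.rpow_nonneg (truncAbs_nonneg x) _)
              (Real.rpow_nonneg (truncAbs_nonneg y) _)
          rw [ENNReal.ofReal_rpow_of_nonneg (specNorm_nonneg _) ht.le, ← ENNReal.ofReal_one,
            ← ENNReal.ofReal_add zero_le_one hnn, ← ENNReal.ofReal_mul (by positivity)]
          exact ENNReal.ofReal_le_ofReal (specNorm_rotatingWeight_rpow_le ht x y)
      _ ≤ _ := by
          rw [lintegral_const_mul' _ _ ENNReal.ofReal_ne_top, lintegral_add_left measurable_const,
            setLIntegral_const, one_mul, Real.volume_Ico]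
          gcongr
          exact setLIntegral_truncAbs_le hx
  calc _ ≤ (ENNReal.ofReal (b - a))⁻¹ * (ENNReal.ofReal (5 ^ t) *
        (ENNReal.ofReal (b - a) + ENNReal.ofReal (17 * (b - a)))) := by
        rw [lavg, Real.volume_Ico]
        gcongr
    _ = _ := by
        have e : ENNReal.ofReal (b - a) + ENNReal.ofReal (17 * (b - a)) =
            ENNReal.ofReal (b - a) * (1 + ENNReal.ofReal 17) := by
          rw [ENNReal.ofReal_mul (by norm_num)]
          ring
        rw [e, mul_left_comm (ENNReal.ofReal (5 ^ t)), ← mul_assoc, ENNReal.inv_mul_cancel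
          (ENNReal.ofReal_pos.2 hl).ne' ENNReal.ofReal_ne_top, one_mul]

lemma le_specNorm_rotatingWeight_rpow {t s r x y : ℝ} (ht : 0 < t) (hs : 0 < s) (hr1 : r ≤ 1)
    (hx0 : 0 < x) (hx : x < r / 2) (hy : 3 / 4 * r ≤ y) (hyr : y < r) :
    (((3 / 4) ^ (1 / 2 * (1 / t)) - (1 / 2) ^ (1 / 2 * (1 / t))) / 4) ^ s *
        r ^ (1 / 2 * (s / t - 1)) ≤
      specNorm (matRpow (rotatingWeight t x) (1 / s) *
        matRpow (rotatingWeight t y) (-(1 / s))) ^ s := by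
  have hr : 0 < r := by linarith
  have hy0 : 0 < y := by linarith
  rw [matRpow_rotatingWeight, matRpow_rotatingWeight, truncAbs_of_mem_Icc hx0.le (by linarith),
    truncAbs_of_mem_Icc hy0.le (by linarith)]
  set β : ℝ := 1 / 2 * (1 / t) with hβ
  have hβ0 : 0 < β := by positivity
  have hM := le_specNorm_lineScale_mul (x ^ (1 / 2 * (1 / s))) (Real.rpow_nonneg hx0.le β)
    (Real.rpow_le_rpow hx0.le (by linarith : x ≤ y) hβ0.le)
    (Real.rpow_le_one hy0.le (by linarith) hβ0.le)
    (Real.rpow_nonneg hy0.le (1 / 2 * -(1 / s)))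
  set κ : ℝ := (3 / 4) ^ β - (1 / 2) ^ β
  have hκ : 0 ≤ κ := sub_nonneg.2 (Real.rpow_le_rpow (by norm_num) (by norm_num) hβ0.le)
  have hslope : κ * r ^ β ≤ y ^ β - x ^ β := by
    have h1 : (3 / 4 * r) ^ β ≤ y ^ β := Real.rpow_le_rpow (by positivity) hy hβ0.le
    have h2 : x ^ β ≤ (1 / 2 * r) ^ β := Real.rpow_le_rpow hx0.le (by linarith) hβ0.le
    rw [Real.mul_rpow (by norm_num) hr.le] at h1 h2
    simp only [κ]
    linarith
  have heig : r ^ (1 / 2 * -(1 / s)) ≤ y ^ (1 / 2 * -(1 / s)) := by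
    have : 0 < 1 / s := by positivity
    exact Real.rpow_le_rpow_of_nonpos hy0 hyr.le (by linarith)
  have hbase : r ^ (1 / 2 * -(1 / s)) * (κ * r ^ β / 4) ≤
      y ^ (1 / 2 * -(1 / s)) * ((y ^ β - x ^ β) / 4) := by
    gcongr
  calc _ = (r ^ (1 / 2 * -(1 / s)) * (κ * r ^ β / 4)) ^ s := by
        have : r ^ (1 / 2 * -(1 / s)) * (κ * r ^ β / 4) =
            κ / 4 * r ^ (1 / 2 * -(1 / s) + β) := by
          rw [Real.rpow_add hr]
          ring
        rw [this, Real.mul_rpow (by positivity) (by positivity), ← Real.rpow_mul hr.le]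
        congr 2
        rw [hβ]
        field_simp
        ring
    _ ≤ _ := Real.rpow_le_rpow (by positivity) (hbase.trans hM) hs.le

lemma le_matAtInfty_rotatingWeight {t s : ℝ} (ht : 0 < t) (hs : 0 < s) (n : ℕ) :
    ENNReal.ofReal ((((3 / 4) ^ (1 / 2 * (1 / t)) - (1 / 2) ^ (1 / 2 * (1 / t))) / 4) ^ s *
        ((2⁻¹ : ℝ) ^ n) ^ (1 / 2 * (s / t - 1)) / 4) ≤
      matAtInfty volume dyadicsR (rotatingWeight t) s := by
  set r : ℝ := (2⁻¹ : ℝ) ^ n with hr_def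
  have hr : 0 < r := by positivity
  have hr1 : r ≤ 1 := pow_le_one₀ (by norm_num) (by norm_num)
  have hQ : Set.Ico 0 r ∈ dyadicsR := ⟨0, -(n : ℤ), by simp [hr_def]⟩
  refine le_trans ?_ (le_iSup₂ (Set.Ico 0 r) hQ)
  set f : ℝ → ℝ≥0∞ := fun x => lavg volume (Set.Ico 0 r) fun y => ENNReal.ofReal (specNorm
    (matRpow (rotatingWeight t x) (1 / s) * matRpow (rotatingWeight t y) (-(1 / s)))) ^ s
  obtain ⟨x, hx, hfx⟩ : ∃ x ∈ Set.Ioo 0 (r / 2),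
      f x ≤ essSup f (volume.restrict (Set.Ico 0 r)) := by
    by_contra! hcon
    have hae : ∀ᵐ x ∂volume.restrict (Set.Ioo 0 (r / 2)),
        f x ≤ essSup f (volume.restrict (Set.Ico 0 r)) :=
      ae_mono (Measure.restrict_mono (Set.Ioo_subset_Ico_self.trans (Set.Ico_subset_Ico_right (by linarith))) le_rfl)
        (ENNReal.ae_le_essSup f)
    have hfalse : ∀ᵐ _ ∂volume.restrict (Set.Ioo 0 (r / 2)), False := by
      filter_upwards [hae, ae_restrict_mem measurableSet_Ioo] with x h1 h2
      exact (hcon x h2).not_ge h1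
    rw [Filter.eventually_false_iff_eq_bot, ae_eq_bot, Measure.restrict_eq_zero,
      Real.volume_Ioo, ENNReal.ofReal_eq_zero] at hfalse
    linarith
  refine le_trans ?_ hfx
  set L : ℝ := (((3 / 4) ^ (1 / 2 * (1 / t)) - (1 / 2) ^ (1 / 2 * (1 / t))) / 4) ^ s *
    r ^ (1 / 2 * (s / t - 1))
  calc ENNReal.ofReal (L / 4)
      = (ENNReal.ofReal r)⁻¹ * (ENNReal.ofReal L * ENNReal.ofReal (r - 3 / 4 * r)) := by
        rw [← ENNReal.ofReal_inv_of_pos hr, ← ENNReal.ofReal_mul' (by linarith),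
          ← ENNReal.ofReal_mul (by positivity)]
        congr 1
        field_simp
        ring
    _ = (volume (Set.Ico 0 r))⁻¹ * ∫⁻ _ in Set.Ico (3 / 4 * r) r, ENNReal.ofReal L := by
        rw [setLIntegral_const, Real.volume_Ico, Real.volume_Ico, sub_zero]
    _ ≤ (volume (Set.Ico 0 r))⁻¹ * ∫⁻ y in Set.Ico (3 / 4 * r) r, ENNReal.ofReal (specNorm
          (matRpow (rotatingWeight t x) (1 / s) *
            matRpow (rotatingWeight t y) (-(1 / s)))) ^ s := by
        refine mul_le_mul_right (setLIntegral_mono' measurableSet_Ico fun y hy => ?_) _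
        rw [ENNReal.ofReal_rpow_of_nonneg (specNorm_nonneg _) hs.le]
        exact ENNReal.ofReal_le_ofReal
          (le_specNorm_rotatingWeight_rpow ht hs hr1 hx.1 hx.2 hy.1 hy.2)
    _ ≤ f x := by
        simp only [f, lavg]
        gcongr
        positivity

lemma matAtInfty_rotatingWeight_eq_top {t s : ℝ} (hs : 0 < s) (hst : s < t) :
    matAtInfty volume dyadicsR (rotatingWeight t) s = ⊤ := by
  have ht : 0 < t := hs.trans hst
  refine top_le_iff.1 (le_of_tendsto' (x := Filter.atTop) ?_
    fun n => le_matAtInfty_rotatingWeight ht hs n)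
  refine ENNReal.tendsto_ofReal_nhds_top.2 ?_
  set κ : ℝ := (3 / 4) ^ (1 / 2 * (1 / t)) - (1 / 2) ^ (1 / 2 * (1 / t))
  have hκ : 0 < κ :=
    sub_pos.2 (Real.rpow_lt_rpow (by norm_num) (by norm_num) (by positivity))
  have hexp : 1 / 2 * (s / t - 1) < 0 := by
    have := (div_lt_one ht).2 hst
    linarith
  have hbase : 1 < (2⁻¹ : ℝ) ^ (1 / 2 * (s / t - 1)) :=
    Real.one_lt_rpow_of_pos_of_lt_one_of_neg (by norm_num) (by norm_num) hexp
  refine ((tendsto_pow_atTop_atTop_of_one_lt hbase).const_mul_atTop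
    (r := (κ / 4) ^ s / 4) (by positivity)).congr fun n => ?_
  rw [← Real.rpow_natCast, ← Real.rpow_natCast, ← Real.rpow_mul (by norm_num),
    ← Real.rpow_mul (by norm_num), mul_comm (n : ℝ)]
  ring

theorem statement5 (t : ℝ) (ht : 1 < t) :
    ∃ W : ℝ → Matrix (Fin 2) (Fin 2) ℂ,
      IsMatrixWeight (volume : Measure ℝ) W ∧
      matAtInfty volume intervalsR W t < ⊤ ∧
      ∀ s : ℝ, 1 ≤ s → s < t → matAtInfty volume dyadicsR W s = ⊤ := by
  exact ⟨rotatingWeight t, isMatrixWeight_rotatingWeight (by linarith),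
    matAtInfty_rotatingWeight_lt_top (by linarith),
    fun s hs hst => matAtInfty_rotatingWeight_eq_top (by linarith) hst⟩

end
end

section
/- For each positive integer n set C_n := [[1, 0], [0, n]] and D_n := [[1, 1/(2√n)], [1/(2√n), 1/n]] as 2×2 real (hence complex Hermitian) matrices. Then C_n and D_n are positive definite for all n; there exist absolute constants 0 < c₁ ≤ c₂ such that c₁ ≤ tr(C_n·D_n) ≤ c₂ and c₁ ≤ tr(C_n^{-1}·D_n^{-1}) ≤ c₂ for all n; and for every real a > 1, tr(C_n^a·D_n^a) → ∞ as n → ∞, where C_n^a and D_n^a are the matrix powers defined by the spectral functional calculus. -/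
open MeasureTheory ENNReal
open scoped ComplexOrder

noncomputable section

/-- The matrix `C_n = [[1,0],[0,n]]`. -/
def Cmat (n : ℕ) : Matrix (Fin 2) (Fin 2) ℂ := !![1, 0; 0, (n : ℂ)]

/-- The matrix `D_n = [[1, 1/(2√n)],[1/(2√n), 1/n]]`. -/
def Dmat (n : ℕ) : Matrix (Fin 2) (Fin 2) ℂ :=
  !![1, 1 / (2 * ((Real.sqrt n : ℝ) : ℂ)); 1 / (2 * ((Real.sqrt n : ℝ) : ℂ)), 1 / (n : ℂ)]

section Auxiliary

open scoped MatrixOrder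

theorem Dmat_isHermitian (n : ℕ) : (Dmat n).IsHermitian := by
  ext i j
  fin_cases i <;> fin_cases j <;> simp [Dmat]

theorem Cmat_isHermitian (n : ℕ) : (Cmat n).IsHermitian := by
  ext i j
  fin_cases i <;> fin_cases j <;> simp [Cmat]

/-- Real spectral values of a `2 × 2` complex matrix are roots of its characteristic polynomial. -/
theorem charpoly_eq_zero_of_mem_spectrum {A : Matrix (Fin 2) (Fin 2) ℂ} {x : ℝ}
    (hx : x ∈ spectrum ℝ A) : ((x : ℂ) - A 0 0) * (x - A 1 1) - A 0 1 * A 1 0 = 0 := by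
  rw [spectrum.mem_iff, Matrix.isUnit_iff_isUnit_det, isUnit_iff_ne_zero, not_not,
    Matrix.det_fin_two] at hx
  simpa [Matrix.algebraMap_matrix_apply] using hx

theorem inv_two_sqrt_sq {n : ℕ} : (1 / (2 * √(n : ℝ))) ^ 2 = 1 / (4 * (n : ℝ)) := by
  rw [div_pow, mul_pow, Real.sq_sqrt (Nat.cast_nonneg n)]
  norm_num

theorem Dmat_eq_ofReal (n : ℕ) : Dmat n =
    !![1, ((1 / (2 * √(n : ℝ)) : ℝ) : ℂ); ((1 / (2 * √(n : ℝ)) : ℝ) : ℂ),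
      ((1 / (n : ℝ) : ℝ) : ℂ)] := by
  simp [Dmat]

theorem pos_and_le_two_of_mem_spectrum_Dmat {n : ℕ} (hn : 1 ≤ n) {x : ℝ}
    (hx : x ∈ spectrum ℝ (Dmat n)) : 0 < x ∧ x ≤ 2 := by
  have h := charpoly_eq_zero_of_mem_spectrum hx
  have hb := inv_two_sqrt_sq (n := n)
  rw [Dmat_eq_ofReal] at h
  generalize 1 / (2 * √(n : ℝ)) = b at h hb
  have h' : (x - 1) * (x - 1 / (n : ℝ)) - b * b = 0 := by
    have := congrArg Complex.re h
    norm_cast at this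
    simpa using this
  have hn' : (1 : ℝ) ≤ n := by exact_mod_cast hn
  have hc : 0 < 1 / (n : ℝ) := by positivity
  have hc1 : 1 / (n : ℝ) ≤ 1 := by rw [div_le_one (by positivity)]; exact hn'
  have hb' : b * b = 1 / (n : ℝ) / 4 := by rw [← sq, hb]; field_simp
  rw [hb'] at h'
  generalize 1 / (n : ℝ) = c at *
  constructor
  · by_contra! hx0
    nlinarith [mul_nonneg_of_nonpos_of_nonpos hx0 hx0]
  · by_contra! hx2
    nlinarith

theorem mem_spectrum_Cmat {n : ℕ} {x : ℝ} (hx : x ∈ spectrum ℝ (Cmat n)) : x = 1 ∨ x = n := by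
  have h := charpoly_eq_zero_of_mem_spectrum hx
  simp only [Cmat, Matrix.of_apply, Matrix.cons_val', Matrix.cons_val_zero,
    Matrix.cons_val_one, Matrix.cons_val_fin_one, mul_zero, sub_zero, mul_eq_zero,
    sub_eq_zero] at h
  exact_mod_cast h

theorem matRpow_Cmat (n : ℕ) (a : ℝ) :
    matRpow (Cmat n) a = !![1, 0; 0, (((n : ℝ) ^ a : ℝ) : ℂ)] := by
  set s : ℝ := ((n : ℝ) ^ a - 1) / (n - 1) with hs
  have hC : IsSelfAdjoint (Cmat n) := Cmat_isHermitian n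
  have hsn : s * (n - 1) = (n : ℝ) ^ a - 1 := by
    rcases eq_or_ne (n : ℝ) 1 with h | h
    · simp [h]
    · rw [hs, div_mul_cancel₀ _ (sub_ne_zero.2 h)]
  have h1 : matRpow (Cmat n) a = cfc (fun x : ℝ => (1 - s) + s * x) (Cmat n) := by
    refine cfc_congr fun x hx => ?_
    rcases mem_spectrum_Cmat hx with rfl | rfl
    · simp
    · linarith
  rw [h1, cfc_const_add _ _ _, cfc_const_mul_id _ _]
  ext i j
  fin_cases i <;> fin_cases j <;> simp [Cmat, Matrix.algebraMap_matrix_apply]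
  rw [← sub_eq_zero]
  have : ((s * (n - 1) : ℝ) : ℂ) = (((n : ℝ) ^ a - 1 : ℝ) : ℂ) := by rw [hsn]
  push_cast at this
  linear_combination this

theorem Dmat_pow_entries (n m : ℕ) : ∃ p q : ℝ, 1 / (2 * √(n : ℝ)) ≤ p ∧ 0 ≤ q ∧
    (Dmat n ^ (m + 1)) 0 1 = p ∧ (Dmat n ^ (m + 1)) 1 1 = q := by
  induction m with
  | zero => exact ⟨_, 1 / (n : ℝ), le_rfl, by positivity, by simp [Dmat], by simp [Dmat]⟩
  | succ m ih =>
    obtain ⟨p, q, hp, hq, h0, h1⟩ := ih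
    have hb : 0 ≤ 1 / (2 * √(n : ℝ)) := by positivity
    refine ⟨p + 1 / (2 * √(n : ℝ)) * q, 1 / (2 * √(n : ℝ)) * p + 1 / (n : ℝ) * q, ?_, ?_, ?_, ?_⟩
    · nlinarith [mul_nonneg hb hq]
    · have := hb.trans hp
      positivity
    · rw [pow_succ', Matrix.mul_apply, Fin.sum_univ_two, h0, h1]
      simp [Dmat]
    · rw [pow_succ', Matrix.mul_apply, Fin.sum_univ_two, h0, h1]
      simp [Dmat]

theorem le_Dmat_pow_apply_one_one (n m : ℕ) :
    1 / (4 * (n : ℝ)) ≤ ((Dmat n ^ (m + 2)) 1 1).re := by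
  obtain ⟨p, q, hp, hq, h0, h1⟩ := Dmat_pow_entries n m
  have hb : 0 ≤ 1 / (2 * √(n : ℝ)) := by positivity
  have h : (Dmat n ^ (m + 2)) 1 1 = ((1 / (2 * √(n : ℝ)) * p + 1 / (n : ℝ) * q : ℝ) : ℂ) := by
    rw [pow_succ', Matrix.mul_apply, Fin.sum_univ_two, h0, h1]
    simp [Dmat]
  rw [h, Complex.ofReal_re, ← inv_two_sqrt_sq, sq]
  have : 0 ≤ 1 / (n : ℝ) * q := by positivity
  linarith [mul_le_mul_of_nonneg_left hp hb]

theorem matRpow_Dmat_apply_zero_zero_nonneg {n : ℕ} (hn : 1 ≤ n) (a : ℝ) :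
    0 ≤ (matRpow (Dmat n) a 0 0).re := by
  have h : 0 ≤ matRpow (Dmat n) a :=
    cfc_nonneg fun x hx => Real.rpow_nonneg (pos_and_le_two_of_mem_spectrum_Dmat hn hx).1.le a
  exact (Complex.le_def.1 ((Matrix.nonneg_iff_posSemidef.1 h).diag_nonneg (i := 0))).1

/-- On `(0, 2]`, a real power dominates a multiple of any higher natural power. -/
theorem half_pow_mul_pow_le_rpow {x a : ℝ} {k : ℕ} (hx : 0 < x) (hx2 : x ≤ 2) (ha : 0 ≤ a)
    (hk : a ≤ k) : (1 / 2) ^ k * x ^ k ≤ x ^ a := by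
  have h1 : (x / 2) ^ (k : ℝ) ≤ (x / 2) ^ a :=
    Real.rpow_le_rpow_of_exponent_ge (by positivity) (by linarith) hk
  have h2 : (x / 2) ^ a ≤ x ^ a :=
    Real.rpow_le_rpow (by positivity) (by linarith) ha
  rw [Real.rpow_natCast] at h1
  calc (1 / 2) ^ k * x ^ k = (x / 2) ^ k := by rw [← mul_pow]; ring
    _ ≤ x ^ a := h1.trans h2

theorem le_matRpow_Dmat_apply_one_one {n : ℕ} (hn : 1 ≤ n) {a : ℝ} (ha : 0 ≤ a) {m : ℕ}
    (hm : a ≤ (m + 2 : ℕ)) :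
    (1 / 2) ^ (m + 2) * (1 / (4 * (n : ℝ))) ≤ (matRpow (Dmat n) a 1 1).re := by
  have hD : IsSelfAdjoint (Dmat n) := Dmat_isHermitian n
  have hle : cfc (fun x : ℝ => (1 / 2 : ℝ) ^ (m + 2) * x ^ (m + 2)) (Dmat n) ≤
      matRpow (Dmat n) a := by
    refine cfc_mono (fun x hx => ?_) (by fun_prop)
      (Real.continuous_rpow_const ha).continuousOn
    obtain ⟨h0, h2⟩ := pos_and_le_two_of_mem_spectrum_Dmat hn hx
    exact half_pow_mul_pow_le_rpow h0 h2 ha hm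
  rw [cfc_const_mul _ _ _, cfc_pow_id _ _] at hle
  have h := (Complex.le_def.1 ((Matrix.le_iff.1 hle).diag_nonneg (i := 1))).1
  have h' := mul_le_mul_of_nonneg_left (le_Dmat_pow_apply_one_one n m)
    (by positivity : (0 : ℝ) ≤ (1 / 2) ^ (m + 2))
  rw [Matrix.sub_apply, Matrix.smul_apply, Complex.sub_re, Complex.smul_re, Complex.zero_re,
    smul_eq_mul] at h
  linarith

theorem Cmat_posDef {n : ℕ} (hn : 1 ≤ n) : (Cmat n).PosDef := by
  have : Cmat n = Matrix.diagonal ![1, (n : ℂ)] := by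
    ext i j
    fin_cases i <;> fin_cases j <;> simp [Cmat]
  rw [this, Matrix.posDef_diagonal_iff]
  intro i
  fin_cases i
  · simp
  · simpa using Nat.pos_of_ne_zero (by omega)

theorem Dmat_posDef {n : ℕ} (hn : 1 ≤ n) : (Dmat n).PosDef := by
  rw [(Dmat_isHermitian n).posDef_iff_eigenvalues_pos]
  exact fun i => (pos_and_le_two_of_mem_spectrum_Dmat hn
    ((Dmat_isHermitian n).eigenvalues_mem_spectrum_real i)).1

theorem inv_two_sqrt_mul_self (n : ℕ) :
    (1 / (2 * ((√(n : ℝ) : ℝ) : ℂ))) * (1 / (2 * ((√(n : ℝ) : ℝ) : ℂ))) = 1 / (4 * (n : ℂ)) := by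
  rw [← sq]
  have h := congrArg Complex.ofReal (inv_two_sqrt_sq (n := n))
  push_cast at h
  exact h

theorem trace_Cmat_mul_Dmat {n : ℕ} (hn : 1 ≤ n) : (Cmat n * Dmat n).trace = 2 := by
  have : (n : ℂ) ≠ 0 := Nat.cast_ne_zero.2 (by omega)
  simp [Matrix.trace_fin_two, Cmat, Dmat, this]
  norm_num

theorem trace_inv_Cmat_mul_inv_Dmat {n : ℕ} (hn : 1 ≤ n) :
    ((Cmat n)⁻¹ * (Dmat n)⁻¹).trace = ((8 / 3 : ℝ) : ℂ) := by
  have hn0 : (n : ℂ) ≠ 0 := Nat.cast_ne_zero.2 (by omega)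
  have hdet : (Dmat n).det = 3 / (4 * n) := by
    rw [Dmat, Matrix.det_fin_two_of, inv_two_sqrt_mul_self]
    field_simp
    norm_num
  have hC : (Cmat n).det = n := by simp [Cmat, Matrix.det_fin_two_of]
  rw [Matrix.inv_def, Matrix.inv_def, hdet, hC, Matrix.adjugate_fin_two, Matrix.adjugate_fin_two]
  simp [Matrix.trace_fin_two, Cmat, Dmat]
  field_simp
  norm_num

theorem tendsto_trace_matRpow_Cmat_mul_matRpow_Dmat {a : ℝ} (ha : 1 < a) :
    Filter.Tendsto (fun n : ℕ => (matRpow (Cmat n) a * matRpow (Dmat n) a).trace.re)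
      Filter.atTop Filter.atTop := by
  obtain ⟨m, hm⟩ := exists_nat_ge a
  have hm' : a ≤ (m + 2 : ℕ) := by push_cast; linarith
  have hlim : Filter.Tendsto (fun n : ℕ => (1 / 2 : ℝ) ^ (m + 2) / 4 * (n : ℝ) ^ (a - 1))
      Filter.atTop Filter.atTop :=
    ((tendsto_rpow_atTop (sub_pos.2 ha)).comp tendsto_natCast_atTop_atTop).const_mul_atTop
      (by positivity)
  refine Filter.tendsto_atTop_mono' _ ?_ hlim
  filter_upwards [Filter.eventually_ge_atTop 1] with n hn
  have hn0 : (0 : ℝ) < n := by exact_mod_cast hn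
  have htr : (matRpow (Cmat n) a * matRpow (Dmat n) a).trace.re =
      (matRpow (Dmat n) a 0 0).re + (n : ℝ) ^ a * (matRpow (Dmat n) a 1 1).re := by
    rw [matRpow_Cmat n, Matrix.trace_fin_two, Matrix.mul_apply, Matrix.mul_apply,
      Fin.sum_univ_two, Fin.sum_univ_two]
    simp
  have h00 := matRpow_Dmat_apply_zero_zero_nonneg hn a
  have h11 := mul_le_mul_of_nonneg_left
    (le_matRpow_Dmat_apply_one_one hn (zero_le_one.trans ha.le) hm') (Real.rpow_nonneg hn0.le a)
  have heq : (1 / 2 : ℝ) ^ (m + 2) / 4 * (n : ℝ) ^ (a - 1) =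
      (n : ℝ) ^ a * ((1 / 2) ^ (m + 2) * (1 / (4 * (n : ℝ)))) := by
    rw [Real.rpow_sub_one hn0.ne']
    field_simp
  rw [htr, heq]
  linarith

end Auxiliary

theorem statement9 :
    (∀ n : ℕ, 1 ≤ n → (Cmat n).PosDef ∧ (Dmat n).PosDef) ∧
    (∃ c₁ c₂ : ℝ, 0 < c₁ ∧ c₁ ≤ c₂ ∧ ∀ n : ℕ, 1 ≤ n →
      ((Cmat n * Dmat n).trace.im = 0 ∧
        c₁ ≤ (Cmat n * Dmat n).trace.re ∧ (Cmat n * Dmat n).trace.re ≤ c₂ ∧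
        ((Cmat n)⁻¹ * (Dmat n)⁻¹).trace.im = 0 ∧
        c₁ ≤ ((Cmat n)⁻¹ * (Dmat n)⁻¹).trace.re ∧
        ((Cmat n)⁻¹ * (Dmat n)⁻¹).trace.re ≤ c₂)) ∧
    ∀ a : ℝ, 1 < a →
      Filter.Tendsto (fun n : ℕ => (matRpow (Cmat n) a * matRpow (Dmat n) a).trace.re)
        Filter.atTop Filter.atTop := by
  refine ⟨fun n hn => ⟨Cmat_posDef hn, Dmat_posDef hn⟩, ⟨2, 8 / 3, by norm_num, by norm_num,
    fun n hn => ?_⟩, fun a ha => tendsto_trace_matRpow_Cmat_mul_matRpow_Dmat ha⟩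
  rw [trace_Cmat_mul_Dmat hn, trace_inv_Cmat_mul_inv_Dmat hn, Complex.ofReal_re,
    Complex.ofReal_im]
  norm_num

end
end

section
/- Let (Ω, 𝒜) be a measurable space, X a Polish space, and let F and G be weakly 𝒜-measurable maps from Ω to the nonempty closed subsets of X. Then the set {ω ∈ Ω : F(ω) ⊆ G(ω)} belongs to 𝒜. -/
open MeasureTheory ENNReal
open scoped ComplexOrder Pointwise

noncomputable section


/-- A set-valued map `F` is weakly `𝒜`-measurable if `{ω | F ω ∩ U ≠ ∅}` is measurable
for every open `U`. -/
def WeaklyMeasurable {Ω X : Type*} [MeasurableSpace Ω] [TopologicalSpace X]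
    (F : Ω → Set X) : Prop :=
  ∀ U : Set X, IsOpen U → MeasurableSet {ω | (F ω ∩ U).Nonempty}

theorem statement15 {Ω X : Type*} [MeasurableSpace Ω]
    [MetricSpace X] [TopologicalSpace.SeparableSpace X] [CompleteSpace X]
    (F G : Ω → Set X)
    (hFne : ∀ ω, (F ω).Nonempty) (hFcl : ∀ ω, IsClosed (F ω))
    (hGne : ∀ ω, (G ω).Nonempty) (hGcl : ∀ ω, IsClosed (G ω))
    (hF : WeaklyMeasurable F) (hG : WeaklyMeasurable G) :
    MeasurableSet {ω | F ω ⊆ G ω} := by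
  have : SecondCountableTopology X := UniformSpace.secondCountable_of_separable X
  have hbasis := TopologicalSpace.isBasis_countableBasis X
  have key : {ω | F ω ⊆ G ω} = ⋂ U ∈ TopologicalSpace.countableBasis X,
      ({ω | (F ω ∩ U).Nonempty}ᶜ ∪ {ω | (G ω ∩ U).Nonempty}) := by
    ext ω
    simp only [Set.mem_ofPred_eq, Set.mem_iInter, Set.mem_union, Set.mem_compl_iff,
      ← imp_iff_not_or]
    refine ⟨fun h U _ hU ↦ hU.mono (Set.inter_subset_inter_left U h), fun h x hx ↦ ?_⟩
    rw [← (hGcl ω).closure_eq, hbasis.mem_closure_iff]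
    intro U hU hxU
    simpa only [Set.inter_comm] using h U hU ⟨x, hx, hxU⟩
  rw [key]
  exact MeasurableSet.biInter (TopologicalSpace.countable_countableBasis X) fun U hU ↦
    (hF U (hbasis.isOpen hU)).compl.union (hG U (hbasis.isOpen hU))

end
end
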